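/- Let K, L, E ⊆ ℝⁿ be convex bodies with 0 ∈ int E, let λ ∈ (0,1), and let u ∈ co(ℝ≥0). Then the generalized Wills functional W_u(·;E) is log-concave with respect to Minkowski combinations: W_u((1−λ)K + λL; E) ≥ W_u(K;E)^{1−λ} · W_u(L;E)^{λ}. -/

import Mathlib

open scoped Pointwise
open MeasureTheory Metric Real

/-- The relative distance `d_E(x,K) = min {t ≥ 0 : x ∈ K + tE}`. -/
noncomputable def distE {V : Type*} [AddCommGroup V] [Module ℝ V] (E K : Set V) (x : V) : ℝ :=
  sInf {t : ℝ | 0 ≤ t ∧ x ∈ K + t • E}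

/-- The generalized Wills functional `W_u(K;E) = ∫_{ℝⁿ} e^{-u(d_E(x,K))} dx`. -/
noncomputable def willsGen {n : ℕ} (u : ℝ → ℝ) (K E : Set (EuclideanSpace ℝ (Fin n))) : ℝ :=
  ∫ x, Real.exp (-u (distE E K x))


open scoped ENNReal

lemma bm_compact {A B : Set ℝ} (hA : IsCompact A) (hB : IsCompact B) (hA0 : A.Nonempty)
    (hB0 : B.Nonempty) : volume A + volume B ≤ volume (A + B) := by
  obtain ⟨x, hx⟩ := hA.exists_isGreatest hA0
  obtain ⟨y, hy⟩ := hB.exists_isLeast hB0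
  have h1 : volume ((fun a => a + y) '' A) = volume A := by simp
  have h2 : volume ((fun b => x + b) '' B) = volume B := by simp
  have hm : MeasurableSet ((fun b => x + b) '' B) :=
    (hB.image (by fun_prop)).measurableSet
  have hd : AEDisjoint volume ((fun a => a + y) '' A) ((fun b => x + b) '' B) := by
    refine measure_mono_null (t := {x + y}) ?_ (by simp)
    rintro z ⟨⟨a, ha, rfl⟩, ⟨b, hb, hab⟩⟩
    have := hx.2 ha
    have := hy.2 hb
    simp only at hab
    simp only [Set.mem_singleton_iff]
    linarith
  rw [← h1, ← h2, ← measure_union₀ hm.nullMeasurableSet hd]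
  apply measure_mono
  rintro z (⟨a, ha, rfl⟩ | ⟨b, hb, rfl⟩)
  · exact Set.add_mem_add ha hy.1
  · exact Set.add_mem_add hx.1 hb

lemma bm_real {A B : Set ℝ} (hA : MeasurableSet A) (hB : MeasurableSet B) (hA0 : A.Nonempty)
    (hB0 : B.Nonempty) : volume A + volume B ≤ volume (A + B) := by
  have key : ∀ A : Set ℝ, MeasurableSet A → A.Nonempty → ∀ r < volume A,
      ∃ K ⊆ A, IsCompact K ∧ K.Nonempty ∧ r ≤ volume K := by
    intro A hA hA0 r hr
    obtain ⟨K, h1, h2, h3⟩ := hA.exists_lt_isCompact hr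
    refine ⟨K, h1, h2, ?_, h3.le⟩
    by_contra h
    rw [Set.not_nonempty_iff_eq_empty] at h
    simp [h] at h3
  have key0 : ∀ A : Set ℝ, A.Nonempty → ∃ K ⊆ A, IsCompact K ∧ K.Nonempty := by
    rintro A ⟨a, ha⟩
    exact ⟨{a}, by simpa using ha, isCompact_singleton, by simp⟩
  by_cases hA1 : volume A = 0
  · obtain ⟨a, ha⟩ := hA0
    rw [hA1, zero_add]
    calc volume B = volume ((fun b => a + b) '' B) := by simp
      _ ≤ _ := by
        apply measure_mono
        rintro _ ⟨b, hb, rfl⟩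
        exact Set.add_mem_add ha hb
  by_cases hB1 : volume B = 0
  · obtain ⟨b, hb⟩ := hB0
    rw [hB1, add_zero]
    calc volume A = volume ((fun a => a + b) '' A) := by simp
      _ ≤ _ := by
        apply measure_mono
        rintro _ ⟨a, ha, rfl⟩
        exact Set.add_mem_add ha hb
  refine le_of_forall_lt fun c hc => ?_
  obtain ⟨r, hr, s, hs, hrs⟩ : ∃ r < volume A, ∃ s < volume B, c < r + s := by
    exact ENNReal.exists_lt_add_of_lt_add hc hA1 hB1
  obtain ⟨K, h1, h2, h3, h4⟩ := key A hA hA0 r hr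
  obtain ⟨L, k1, k2, k3, k4⟩ := key B hB hB0 s hs
  calc c < r + s := hrs
    _ ≤ volume K + volume L := add_le_add h4 k4
    _ ≤ volume (K + L) := bm_compact h2 k2 h3 k3
    _ ≤ _ := measure_mono (Set.add_subset_add h1 k1)

lemma amgm {l : ℝ} (hl : l ∈ Set.Ioo (0 : ℝ) 1) (a b : ℝ≥0∞) :
    a ^ (1 - l) * b ^ l ≤ ENNReal.ofReal (1 - l) * a + ENNReal.ofReal l * b := by
  have h1 : 0 < 1 - l := by linarith [hl.2]
  have h2 := hl.1
  have hpq : ((1-l)⁻¹).HolderConjugate (l⁻¹) := by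
    rw [Real.holderConjugate_iff]
    constructor
    · exact (one_lt_inv₀ h1).2 (by linarith)
    · simp
  refine (ENNReal.young_inequality (a ^ (1 - l)) (b ^ l) hpq).trans (le_of_eq ?_)
  rw [← ENNReal.rpow_mul, ← ENNReal.rpow_mul, mul_inv_cancel₀ h1.ne', mul_inv_cancel₀ h2.ne',
    ENNReal.rpow_one, ENNReal.rpow_one, ENNReal.ofReal_inv_of_pos h1, ENNReal.ofReal_inv_of_pos h2,
    div_eq_mul_inv, div_eq_mul_inv, inv_inv, inv_inv, mul_comm a, mul_comm b]

/-- normalized one-dimensional Prekopa-Leindler, in arithmetic form -/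
lemma pl_norm {l : ℝ} (hl : l ∈ Set.Ioo (0 : ℝ) 1) {f g h : ℝ → ℝ≥0∞} (hf : Measurable f)
    (hg : Measurable g) (hh : Measurable h) (hf1 : ⨆ x, f x = 1) (hg1 : ⨆ x, g x = 1)
    (H : ∀ x y, f x ^ (1 - l) * g y ^ l ≤ h ((1 - l) * x + l * y)) :
    ENNReal.ofReal (1 - l) * (∫⁻ x, f x) + ENNReal.ofReal l * (∫⁻ x, g x) ≤ ∫⁻ x, h x := by
  have h1 : 0 < 1 - l := by linarith [hl.2]
  have h2 := hl.1
  have hfle : ∀ x, f x ≤ 1 := fun x => hf1 ▸ le_iSup f x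
  have hgle : ∀ x, g x ≤ 1 := fun x => hg1 ▸ le_iSup g x
  have lc : ∀ k : ℝ → ℝ≥0∞, Measurable k → (∀ x, k x ≤ 1) →
      ∫⁻ x, k x = ∫⁻ t in Set.Ioi (0:ℝ), volume {x | ENNReal.ofReal t < k x} := by
    intro k hk hk1
    have hkt : ∀ x, k x ≠ ∞ := fun x => ne_top_of_le_ne_top ENNReal.one_ne_top (hk1 x)
    have := lintegral_eq_lintegral_meas_lt volume (f := fun x => (k x).toReal)
      (Filter.Eventually.of_forall fun x => ENNReal.toReal_nonneg) hk.ennreal_toReal.aemeasurable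
    simp only [ENNReal.ofReal_toReal (hkt _)] at this
    rw [this]
    refine setLIntegral_congr_fun measurableSet_Ioi fun t ht => ?_
    simp only [ENNReal.ofReal_lt_iff_lt_toReal (le_of_lt ht) (hkt _)]
  have meas : ∀ k : ℝ → ℝ≥0∞, Measurable (fun t : ℝ => volume {x | ENNReal.ofReal t < k x}) := by
    intro k
    apply Antitone.measurable
    intro s t hst
    apply measure_mono
    intro x hx
    exact lt_of_le_of_lt (ENNReal.ofReal_le_ofReal hst) hx
  have hmin : ∫⁻ x, min (h x) 1 ≤ ∫⁻ x, h x := lintegral_mono fun x => min_le_left _ _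
  refine le_trans ?_ hmin
  rw [lc f hf hfle, lc g hg hgle, lc _ (hh.min measurable_const) (fun x => min_le_right _ _),
    ← lintegral_const_mul _ (meas f), ← lintegral_const_mul _ (meas g),
    ← lintegral_add_left ((meas f).const_mul _)]
  refine setLIntegral_mono' measurableSet_Ioi fun t ht => ?_
  rcases lt_or_ge t 1 with ht1 | ht1
  · have hT : ENNReal.ofReal t < 1 := by simpa using ht1
    have hT0 : ENNReal.ofReal t ≠ 0 := by simpa using ht
    have e1 : ({x | ENNReal.ofReal t < f x}).Nonempty := by
      rw [← hf1] at hT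
      exact lt_iSup_iff.1 hT
    have e2 : ({x | ENNReal.ofReal t < g x}).Nonempty := by
      rw [← hg1] at hT
      exact lt_iSup_iff.1 hT
    have m1 : MeasurableSet {x | ENNReal.ofReal t < f x} := measurableSet_lt measurable_const hf
    have m2 : MeasurableSet {x | ENNReal.ofReal t < g x} := measurableSet_lt measurable_const hg
    have v : ∀ (r : ℝ) (_ : 0 < r) (S : Set ℝ), volume (r • S) = ENNReal.ofReal r * volume S := by
      intro r hr S
      rw [Measure.addHaar_smul]; simp [abs_of_pos hr]
    rw [← v _ h1, ← v _ h2]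
    refine (bm_real (m1.const_smul₀ _) (m2.const_smul₀ _) e1.smul_set e2.smul_set).trans ?_
    apply measure_mono
    rintro _ ⟨_, ⟨x, hx, rfl⟩, _, ⟨y, hy, rfl⟩, rfl⟩
    simp only [Set.mem_ofPred_eq, smul_eq_mul] at hx hy ⊢
    refine lt_min (lt_of_lt_of_le ?_ (H x y)) hT
    calc ENNReal.ofReal t = ENNReal.ofReal t ^ (1 - l) * ENNReal.ofReal t ^ l := by
          rw [← ENNReal.rpow_add _ _ hT0 ENNReal.ofReal_ne_top]; simp
      _ < _ := ENNReal.mul_lt_mul (ENNReal.rpow_lt_rpow hx h1) (ENNReal.rpow_lt_rpow hy h2)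
  · have hT : 1 ≤ ENNReal.ofReal t := by simpa using ht1
    have e1 : {x | ENNReal.ofReal t < f x} = ∅ := by
      ext x; simpa using (hfle x).trans hT
    have e2 : {x | ENNReal.ofReal t < g x} = ∅ := by
      ext x; simpa using (hgle x).trans hT
    simp [e1, e2]

lemma pl_bdd {l : ℝ} (hl : l ∈ Set.Ioo (0 : ℝ) 1) {f g h : ℝ → ℝ≥0∞} (hf : Measurable f)
    (hg : Measurable g) (hh : Measurable h) (hf1 : ⨆ x, f x ≠ ∞) (hg1 : ⨆ x, g x ≠ ∞)
    (H : ∀ x y, f x ^ (1 - l) * g y ^ l ≤ h ((1 - l) * x + l * y)) :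
    (∫⁻ x, f x) ^ (1 - l) * (∫⁻ x, g x) ^ l ≤ ∫⁻ x, h x := by
  have h1 : 0 < 1 - l := by linarith [hl.2]
  have h2 := hl.1
  by_cases hf0 : ⨆ x, f x = 0
  · have : ∀ x, f x = 0 := by simpa using hf0
    simp [this, h1]
  by_cases hg0 : ⨆ x, g x = 0
  · have : ∀ x, g x = 0 := by simpa using hg0
    simp [this, h2]
  set a := ⨆ x, f x with ha
  set b := ⨆ x, g x with hb
  have c0 : a ^ (1 - l) * b ^ l ≠ 0 :=
    mul_ne_zero (by simp [hf0, hf1]) (by simp [hg0, hg1])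
  have ct : a ^ (1 - l) * b ^ l ≠ ∞ :=
    ENNReal.mul_ne_top (ENNReal.rpow_ne_top_of_nonneg h1.le hf1)
      (ENNReal.rpow_ne_top_of_nonneg h2.le hg1)
  have e : ∀ x y : ℝ≥0∞, (a⁻¹ * x) ^ (1 - l) * (b⁻¹ * y) ^ l
      = (a ^ (1 - l) * b ^ l)⁻¹ * (x ^ (1 - l) * y ^ l) := by
    intro x y
    rw [ENNReal.mul_rpow_of_nonneg _ _ h1.le, ENNReal.mul_rpow_of_nonneg _ _ h2.le,
      ENNReal.inv_rpow, ENNReal.inv_rpow, ENNReal.mul_inv (by simp [hf0, hf1]) (by simp [hg0, hg1])]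
    ring
  have := pl_norm hl (hf.const_mul a⁻¹) (hg.const_mul b⁻¹) (hh.const_mul (a ^ (1 - l) * b ^ l)⁻¹)
    (by rw [← ENNReal.mul_iSup, ← ha, ENNReal.inv_mul_cancel hf0 hf1])
    (by rw [← ENNReal.mul_iSup, ← hb, ENNReal.inv_mul_cancel hg0 hg1])
    (fun x y => by rw [e]; gcongr; exact H x y)
  have := (amgm hl _ _).trans this
  rw [lintegral_const_mul _ hf, lintegral_const_mul _ hg, lintegral_const_mul _ hh, e] at this
  rwa [ENNReal.mul_le_mul_iff_right (by simpa using ct) (by simpa using c0)] at this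

lemma pl_real {l : ℝ} (hl : l ∈ Set.Ioo (0 : ℝ) 1) {f g h : ℝ → ℝ≥0∞} (hf : Measurable f)
    (hg : Measurable g) (hh : Measurable h)
    (H : ∀ x y, f x ^ (1 - l) * g y ^ l ≤ h ((1 - l) * x + l * y)) :
    (∫⁻ x, f x) ^ (1 - l) * (∫⁻ x, g x) ^ l ≤ ∫⁻ x, h x := by
  have h1 : 0 < 1 - l := by linarith [hl.2]
  have h2 := hl.1
  by_cases hf0 : ∫⁻ x, f x = 0
  · simp [hf0, h1]
  by_cases hg0 : ∫⁻ x, g x = 0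
  · simp [hg0, h2]
  have T : ∀ k : ℝ → ℝ≥0∞, Measurable k →
      Filter.Tendsto (fun M : ℕ => ∫⁻ x, min (k x) M) Filter.atTop (nhds (∫⁻ x, k x)) := by
    intro k hk
    apply lintegral_tendsto_of_tendsto_of_monotone
    · intro M
      exact (hk.min measurable_const).aemeasurable
    · refine Filter.Eventually.of_forall fun x m n hmn => ?_
      simp only
      gcongr
    · refine Filter.Eventually.of_forall fun x => ?_
      have := (tendsto_const_nhds (x := k x)).min ENNReal.tendsto_nat_nhds_top
      simpa using this
  have T1 := ((ENNReal.continuous_rpow_const (y := 1 - l)).tendsto _).comp (T f hf)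
  have T2 := ((ENNReal.continuous_rpow_const (y := l)).tendsto _).comp (T g hg)
  have T3 := ENNReal.Tendsto.mul T1 (Or.inl (by simp [hf0, h1, hl.2.le])) T2
    (Or.inl (by simp [hg0, h2, h2.le]))
  refine le_of_tendsto T3 (Filter.Eventually.of_forall fun M => ?_)
  refine pl_bdd hl (hf.min measurable_const) (hg.min measurable_const) hh ?_ ?_ ?_
  · exact ne_top_of_le_ne_top (ENNReal.natCast_ne_top M) (iSup_le fun x => min_le_right _ _)
  · exact ne_top_of_le_ne_top (ENNReal.natCast_ne_top M) (iSup_le fun x => min_le_right _ _)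
  · intro x y
    refine le_trans ?_ (H x y)
    gcongr <;> exact min_le_left _ _

lemma pl_pi {l : ℝ} (hl : l ∈ Set.Ioo (0 : ℝ) 1) (n : ℕ) : ∀ {f g h : (Fin n → ℝ) → ℝ≥0∞}
    (_ : Measurable f) (_ : Measurable g) (_ : Measurable h)
    (_ : ∀ x y, f x ^ (1 - l) * g y ^ l ≤ h ((1 - l) • x + l • y)),
    (∫⁻ x, f x) ^ (1 - l) * (∫⁻ x, g x) ^ l ≤ ∫⁻ x, h x := by
  induction n with
  | zero =>
    intro f g h hf hg hh H
    have e : ∀ k : (Fin 0 → ℝ) → ℝ≥0∞, ∫⁻ x, k x = k 0 := by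
      intro k
      have hv : (volume : Measure (Fin 0 → ℝ)) Set.univ = 1 := by
        rw [volume_pi, Measure.pi_univ]; simp
      rw [lintegral_unique, hv, mul_one]
      congr 1
      exact Subsingleton.elim _ _
    rw [e, e, e]
    simpa using H 0 0
  | succ n ih =>
    intro f g h hf hg hh H
    have mp := (volume_preserving_piFinSuccAbove (fun _ : Fin (n + 1) => ℝ) 0).symm
    have mm := (MeasurableEquiv.piFinSuccAbove (fun _ : Fin (n + 1) => ℝ) 0).symm.measurable
    have e : ∀ k : (Fin (n+1) → ℝ) → ℝ≥0∞, Measurable k → ∫⁻ x, k x =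
        ∫⁻ t : ℝ, ∫⁻ y : Fin n → ℝ,
          k ((MeasurableEquiv.piFinSuccAbove (fun _ : Fin (n + 1) => ℝ) 0).symm (t, y)) := by
      intro k hk
      rw [← mp.lintegral_comp hk]
      exact lintegral_prod _ (hk.comp mm).aemeasurable
    rw [e f hf, e g hg, e h hh]
    have m : ∀ k : (Fin (n+1) → ℝ) → ℝ≥0∞, Measurable k → Measurable (fun t : ℝ =>
        ∫⁻ y : Fin n → ℝ,
          k ((MeasurableEquiv.piFinSuccAbove (fun _ : Fin (n + 1) => ℝ) 0).symm (t, y))) :=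
      fun k hk => (hk.comp mm).lintegral_prod_right'
    refine pl_real hl (m f hf) (m g hg) (m h hh) fun s t => ?_
    have ms : ∀ s : ℝ, Measurable fun y : Fin n → ℝ =>
      ((MeasurableEquiv.piFinSuccAbove (fun _ : Fin (n + 1) => ℝ) 0).symm (s, y)) :=
      fun s => mm.comp measurable_prodMk_left
    refine ih (hf.comp (ms s)) (hg.comp (ms t)) (hh.comp (ms _)) fun x y => ?_
    refine (H _ _).trans (le_of_eq ?_)
    congr 1
    ext i
    refine Fin.cases ?_ (fun j => ?_) i <;> simp [MeasurableEquiv.piFinSuccAbove]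

lemma pl_euclid {l : ℝ} (hl : l ∈ Set.Ioo (0 : ℝ) 1) {n : ℕ}
    {f g h : EuclideanSpace ℝ (Fin n) → ℝ≥0∞}
    (hf : Measurable f) (hg : Measurable g) (hh : Measurable h)
    (H : ∀ x y, f x ^ (1 - l) * g y ^ l ≤ h ((1 - l) • x + l • y)) :
    (∫⁻ x, f x) ^ (1 - l) * (∫⁻ x, g x) ^ l ≤ ∫⁻ x, h x := by
  have mp := PiLp.volume_preserving_toLp (Fin n)
  rw [← mp.lintegral_comp hf, ← mp.lintegral_comp hg, ← mp.lintegral_comp hh]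
  refine pl_pi hl n (hf.comp mp.measurable) (hg.comp mp.measurable) (hh.comp mp.measurable) ?_
  intro x y
  simpa using H _ _

section dist
variable {V : Type*} [NormedAddCommGroup V] [NormedSpace ℝ V]

lemma distE_nonneg (E K : Set V) (x : V) : 0 ≤ distE E K x :=
  Real.sInf_nonneg fun _ ht => ht.1

lemma distE_set_nonempty {E K : Set V} (hE : (0 : V) ∈ interior E) (hK : K.Nonempty) (x : V) :
    {t : ℝ | 0 ≤ t ∧ x ∈ K + t • E}.Nonempty := by
  obtain ⟨k, hk⟩ := hK
  obtain ⟨r, hr, hrE⟩ := Metric.mem_nhds_iff.1 (mem_interior_iff_mem_nhds.1 hE)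
  have hp : 0 < (‖x - k‖ + 1) / r := by positivity
  refine ⟨(‖x - k‖ + 1) / r, hp.le, ?_⟩
  refine ⟨k, hk, x - k, ?_, by simp⟩
  rw [Set.mem_smul_set_iff_inv_smul_mem₀ hp.ne']
  apply hrE
  rw [mem_ball_zero_iff, norm_smul, Real.norm_of_nonneg (inv_nonneg.2 hp.le), inv_div,
    div_mul_eq_mul_div, div_lt_iff₀ (by positivity)]
  gcongr
  linarith

lemma distE_le {E K : Set V} {x : V} {t : ℝ} (ht : 0 ≤ t) (hx : x ∈ K + t • E) :
    distE E K x ≤ t :=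
  csInf_le ⟨0, fun _ h => h.1⟩ ⟨ht, hx⟩

lemma distE_comb {E K L : Set V} (hE : (0 : V) ∈ interior E) (hE₂ : Convex ℝ E)
    (hK : K.Nonempty) (hL : L.Nonempty) {a b : ℝ} (ha : 0 ≤ a) (hb : 0 ≤ b) (hab : a + b = 1)
    (x y : V) :
    distE E (a • K + b • L) (a • x + b • y) ≤ a * distE E K x + b * distE E L y := by
  refine le_of_forall_pos_le_add fun ε hε => ?_
  obtain ⟨t, ht, ht'⟩ := exists_lt_of_csInf_lt (distE_set_nonempty hE hK x)
    (show sInf _ < distE E K x + ε from lt_add_of_pos_right _ hε)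
  obtain ⟨s, hs, hs'⟩ := exists_lt_of_csInf_lt (distE_set_nonempty hE hL y)
    (show sInf _ < distE E L y + ε from lt_add_of_pos_right _ hε)
  have key : distE E (a • K + b • L) (a • x + b • y) ≤ a * t + b * s := by
    refine distE_le (add_nonneg (mul_nonneg ha ht.1) (mul_nonneg hb hs.1)) ?_
    rw [hE₂.add_smul (mul_nonneg ha ht.1) (mul_nonneg hb hs.1)]
    obtain ⟨k, hk, _, ⟨e, he, rfl⟩, rfl⟩ := ht.2
    obtain ⟨k', hk', _, ⟨e', he', rfl⟩, rfl⟩ := hs.2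
    refine ⟨a • k + b • k', Set.add_mem_add (Set.smul_mem_smul_set hk) (Set.smul_mem_smul_set hk'),
      (a * t) • e + (b * s) • e',
      Set.add_mem_add (Set.smul_mem_smul_set he) (Set.smul_mem_smul_set he'), ?_⟩
    simp only [smul_add, smul_smul]
    abel
  have := mul_le_mul_of_nonneg_left ht'.le ha
  have := mul_le_mul_of_nonneg_left hs'.le hb
  have : a * ε + b * ε = ε := by rw [← add_mul, hab, one_mul]
  linarith

lemma distE_anti {E K L : Set V} (hE : (0 : V) ∈ interior E) (hK : K.Nonempty) (hKL : K ⊆ L)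
    (x : V) : distE E L x ≤ distE E K x :=
  le_csInf (distE_set_nonempty hE hK x) fun _ ht =>
    distE_le ht.1 (Set.add_subset_add_right hKL ht.2)

lemma distE_convex {E K : Set V} (hE : (0 : V) ∈ interior E) (hE₂ : Convex ℝ E)
    (hK : K.Nonempty) (hK₂ : Convex ℝ K) : ConvexOn ℝ Set.univ (distE E K) := by
  refine ⟨convex_univ, fun x _ y _ a b ha hb hab => ?_⟩
  refine (distE_anti hE ?_ ?_ _).trans (distE_comb hE hE₂ hK hK ha hb hab x y)
  · exact hK.smul_set.add hK.smul_set
  · exact convex_iff_pointwise_add_subset.1 hK₂ ha hb hab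

lemma distE_continuous [FiniteDimensional ℝ V] {E K : Set V} (hE : (0 : V) ∈ interior E)
    (hE₂ : Convex ℝ E) (hK : K.Nonempty) (hK₂ : Convex ℝ K) : Continuous (distE E K) := by
  rw [← continuousOn_univ]
  exact (distE_convex hE hE₂ hK hK₂).continuousOn isOpen_univ

lemma distE_lower {E K : Set V} (hE : (0 : V) ∈ interior E) (hE₁ : IsCompact E)
    (hK : K.Nonempty) (hK₁ : IsCompact K) :
    ∃ R > 0, ∃ C, ∀ x, ‖x‖ ≤ C + distE E K x * R := by
  obtain ⟨C, hC⟩ := hK₁.isBounded.exists_norm_le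
  obtain ⟨R, hR0, hR⟩ := hE₁.isBounded.exists_pos_norm_le
  refine ⟨R, hR0, C, fun x => ?_⟩
  have : (‖x‖ - C) / R ≤ distE E K x := by
    refine le_csInf (distE_set_nonempty hE hK x) ?_
    rintro t ⟨ht, k, hk, _, ⟨e, he, rfl⟩, rfl⟩
    rw [div_le_iff₀ hR0]
    have h1 : ‖k + t • e‖ ≤ ‖k‖ + t * ‖e‖ := by
      refine (norm_add_le _ _).trans ?_
      rw [norm_smul, Real.norm_of_nonneg ht]
    have := mul_le_mul_of_nonneg_left (hR e he) ht
    have := hC k hk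
    simp only
    linarith
  rw [div_le_iff₀ hR0] at this
  linarith

end dist

lemma integrable_exp_neg_mul_norm_aux {n : ℕ} {b : ℝ} (hb : 0 < b) :
    Integrable (fun x : EuclideanSpace ℝ (Fin n) => Real.exp (-(b * ‖x‖))) := by
  have h := integrable_one_add_norm (E := EuclideanSpace ℝ (Fin n)) (μ := volume)
    (r := ((n + 1 : ℕ) : ℝ)) (by simp)
  refine (h.const_mul ((n + 1).factorial * (min b 1)⁻¹ ^ (n + 1) * Real.exp (min b 1))).mono'
    (by fun_prop) (Filter.Eventually.of_forall fun x => ?_)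
  set c := min b 1 with hc
  have hc0 : 0 < c := lt_min hb one_pos
  have hcb : c ≤ b := min_le_left _ _
  have hx := norm_nonneg x
  rw [Real.norm_of_nonneg (Real.exp_pos _).le]
  have h1 := Real.pow_div_factorial_le_exp (c * (1 + ‖x‖)) (by positivity) (n + 1)
  rw [div_le_iff₀ (by positivity), mul_pow] at h1
  have h2 : Real.exp (-(b * ‖x‖)) ≤ Real.exp c * (Real.exp (c * (1 + ‖x‖)))⁻¹ := by
    rw [← Real.exp_neg, ← Real.exp_add, Real.exp_le_exp]
    nlinarith
  refine h2.trans ?_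
  rw [Real.rpow_neg (by positivity), Real.rpow_natCast]
  have h3 : (Real.exp (c * (1 + ‖x‖)))⁻¹ ≤
      (n + 1).factorial * c⁻¹ ^ (n + 1) * ((1 + ‖x‖) ^ (n + 1))⁻¹ := by
    rw [inv_le_iff_one_le_mul₀ (Real.exp_pos _), inv_pow]
    have hq : ((n + 1).factorial : ℝ) * (c ^ (n + 1))⁻¹ * ((1 + ‖x‖) ^ (n + 1))⁻¹ *
        Real.exp (c * (1 + ‖x‖)) = (Real.exp (c * (1 + ‖x‖)) * (n + 1).factorial) /
        (c ^ (n + 1) * (1 + ‖x‖) ^ (n + 1)) := by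
      rw [div_eq_mul_inv, mul_inv]; ring
    rw [hq, le_div_iff₀ (by positivity), one_mul]
    exact h1
  calc _ ≤ Real.exp c * ((n + 1).factorial * c⁻¹ ^ (n + 1) * ((1 + ‖x‖) ^ (n + 1))⁻¹) := by gcongr
    _ = _ := by ring

lemma u_lower {u : ℝ → ℝ} (hu₁ : ConvexOn ℝ (Set.Ici 0) u) (hu₂ : MonotoneOn u (Set.Ici 0))
    (h : ¬ ∀ t, 0 ≤ t → u t = u 0) : ∃ a > 0, ∃ c, ∀ t, 0 ≤ t → a * t - c ≤ u t := by
  push Not at h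
  obtain ⟨s, hs, hsu⟩ := h
  have hs0 : 0 < s := lt_of_le_of_ne hs (by rintro rfl; exact hsu rfl)
  have hlt : u 0 < u s :=
    lt_of_le_of_ne (hu₂ (Set.mem_Ici.2 le_rfl) (Set.mem_Ici.2 hs) hs) (Ne.symm hsu)
  have ha : 0 < (u s - u 0) / s := div_pos (by linarith) hs0
  have has : (u s - u 0) / s * s = u s - u 0 := by field_simp
  refine ⟨(u s - u 0) / s, ha, (u s - u 0) / s * s - u 0, fun t ht => ?_⟩
  rcases le_or_gt t s with hts | hts
  · have := hu₂ (Set.mem_Ici.2 le_rfl) (Set.mem_Ici.2 ht) ht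
    nlinarith
  · have := hu₁.secant_mono_aux2 (x := 0) (y := s) (z := t) (Set.mem_Ici.2 le_rfl)
      (Set.mem_Ici.2 ht) hs0 hts
    simp only [sub_zero] at this
    rw [le_div_iff₀ (by linarith)] at this
    linarith

lemma wills_integrable {n : ℕ} {K E : Set (EuclideanSpace ℝ (Fin n))}
    (hK₁ : IsCompact K) (hK₂ : Convex ℝ K) (hK₃ : K.Nonempty)
    (hE₁ : IsCompact E) (hE₂ : Convex ℝ E) (hE₃ : (0 : EuclideanSpace ℝ (Fin n)) ∈ interior E)
    {u : ℝ → ℝ} (hu₁ : ConvexOn ℝ (Set.Ici 0) u) (hu₂ : MonotoneOn u (Set.Ici 0))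
    (hu₃ : ContinuousOn u (Set.Ici 0)) (h : ¬ ∀ t, 0 ≤ t → u t = u 0) :
    Integrable (fun x => Real.exp (-u (distE E K x))) := by
  obtain ⟨R, hR, C, hC⟩ := distE_lower hE₃ hE₁ hK₃ hK₁
  obtain ⟨a, ha, c, hc⟩ := u_lower hu₁ hu₂ h
  have cont : Continuous (fun x => Real.exp (-u (distE E K x))) :=
    Real.continuous_exp.comp (hu₃.comp_continuous (distE_continuous hE₃ hE₂ hK₃ hK₂)
      fun x => distE_nonneg _ _ _).neg
  refine ((integrable_exp_neg_mul_norm_aux (n := n) (div_pos ha hR)).const_mul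
    (Real.exp (c + a / R * C))).mono' cont.aestronglyMeasurable
    (Filter.Eventually.of_forall fun x => ?_)
  rw [Real.norm_of_nonneg (Real.exp_pos _).le, ← Real.exp_add, Real.exp_le_exp]
  have h1 := hc _ (distE_nonneg E K x)
  have h2 := mul_le_mul_of_nonneg_left (hC x) (div_pos ha hR).le
  have h3 : a / R * (C + distE E K x * R) = a / R * C + a * distE E K x := by field_simp
  linarith

theorem willsGen_log_concave {n : ℕ} (K L E : Set (EuclideanSpace ℝ (Fin n)))
    (hK₁ : IsCompact K) (hK₂ : Convex ℝ K) (hK₃ : K.Nonempty)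
    (hL₁ : IsCompact L) (hL₂ : Convex ℝ L) (hL₃ : L.Nonempty)
    (hE₁ : IsCompact E) (hE₂ : Convex ℝ E) (hE₃ : (0 : EuclideanSpace ℝ (Fin n)) ∈ interior E)
    (u : ℝ → ℝ) (hu₁ : ConvexOn ℝ (Set.Ici 0) u) (hu₂ : MonotoneOn u (Set.Ici 0))
    (hu₃ : ContinuousOn u (Set.Ici 0))
    {l : ℝ} (hl : l ∈ Set.Ioo (0 : ℝ) 1) :
    willsGen u ((1 - l) • K + l • L) E ≥ willsGen u K E ^ (1 - l) * willsGen u L E ^ l := by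
  have h1 : 0 < 1 - l := by linarith [hl.2]
  have h2 := hl.1
  by_cases hconst : ∀ t, 0 ≤ t → u t = u 0
  · have e : ∀ M, willsGen u M E = ∫ x : EuclideanSpace ℝ (Fin n), Real.exp (-u 0) := by
      intro M
      unfold willsGen
      simp only [hconst _ (distE_nonneg E M _)]
    rw [e, e, e]
    set I := ∫ x : EuclideanSpace ℝ (Fin n), Real.exp (-u 0) with hI
    have hI0 : 0 ≤ I := integral_nonneg fun _ => (Real.exp_pos _).le
    refine le_of_eq ?_
    rw [← Real.rpow_add_of_nonneg hI0 h1.le h2.le]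
    simp
  set M := (1 - l) • K + l • L with hM
  have hM₁ : IsCompact M := (hK₁.smul _).add (hL₁.smul _)
  have hM₂ : Convex ℝ M := (hK₂.smul _).add (hL₂.smul _)
  have hM₃ : M.Nonempty := hK₃.smul_set.add hL₃.smul_set
  have m : ∀ N : Set (EuclideanSpace ℝ (Fin n)), Convex ℝ N → N.Nonempty →
      Measurable (fun x => ENNReal.ofReal (Real.exp (-u (distE E N x)))) := fun N hN hN' =>
    (Real.continuous_exp.comp (hu₃.comp_continuous (distE_continuous hE₃ hE₂ hN' hN)
      fun x => distE_nonneg _ _ _).neg).measurable.ennreal_ofReal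
  have PL := pl_euclid hl (m K hK₂ hK₃) (m L hL₂ hL₃) (m M hM₂ hM₃) (by
    intro x y
    rw [ENNReal.ofReal_rpow_of_pos (Real.exp_pos _), ENNReal.ofReal_rpow_of_pos (Real.exp_pos _),
      ← ENNReal.ofReal_mul (by positivity)]
    apply ENNReal.ofReal_le_ofReal
    rw [← Real.exp_mul, ← Real.exp_mul, ← Real.exp_add, Real.exp_le_exp]
    have k1 := distE_comb hE₃ hE₂ hK₃ hL₃ h1.le h2.le (by ring) x y
    have dx := distE_nonneg E K x
    have dy := distE_nonneg E L y
    have k2 := hu₂ (Set.mem_Ici.2 (distE_nonneg _ _ _)) (Set.mem_Ici.2 (by positivity)) k1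
    have k3 := hu₁.2 (Set.mem_Ici.2 dx) (Set.mem_Ici.2 dy) h1.le h2.le (by ring)
    simp only [smul_eq_mul] at k3
    linarith)
  have iM := wills_integrable hM₁ hM₂ hM₃ hE₁ hE₂ hE₃ hu₁ hu₂ hu₃ hconst
  have iK := wills_integrable hK₁ hK₂ hK₃ hE₁ hE₂ hE₃ hu₁ hu₂ hu₃ hconst
  have iL := wills_integrable hL₁ hL₂ hL₃ hE₁ hE₂ hE₃ hu₁ hu₂ hu₃ hconst
  have nn : ∀ N : Set (EuclideanSpace ℝ (Fin n)), 0 ≤ willsGen u N E := fun N =>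
    integral_nonneg fun _ => (Real.exp_pos _).le
  have cv : ∀ N : Set (EuclideanSpace ℝ (Fin n)),
      Integrable (fun x => Real.exp (-u (distE E N x))) →
      ∫⁻ x, ENNReal.ofReal (Real.exp (-u (distE E N x))) = ENNReal.ofReal (willsGen u N E) :=
    fun N hN => (ofReal_integral_eq_lintegral_ofReal hN
      (Filter.Eventually.of_forall fun _ => (Real.exp_pos _).le)).symm
  rw [cv _ iM, cv _ iK, cv _ iL, ENNReal.ofReal_rpow_of_nonneg (nn _) h1.le,
    ENNReal.ofReal_rpow_of_nonneg (nn _) h2.le,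
    ← ENNReal.ofReal_mul (Real.rpow_nonneg (nn _) _)] at PL
  exact (ENNReal.ofReal_le_ofReal_iff (nn _)).1 PL
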